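/- For the walk driven by −Δ^#, let L_∞(e) = lim_{n→∞} L_n(e) ∈ ℕ ∪ {∞} be the total number of jumps along the edge e. Then with positive probability the following hold: L_∞(e) < ∞ for every edge e, and (log L_∞(y + 1/2)) / (y · log 2) → 1 as y → +∞ (the total number of visits to the edge {y, y+1} grows like 2^{y + o(y)}). -/

import Mathlib

open MeasureTheory Real Filter Set

noncomputable section

/-- Number of crossings of the edge `{e, e+1}` (i.e. the half-integer edge `e + 1/2`)
before time `n`. -/
def locTime {Ω : Type*} (X : ℕ → Ω → ℤ) (n : ℕ) (e : ℤ) (ω : Ω) : ℕ :=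
  ((Finset.range n).filter fun m => min (X m ω) (X (m + 1) ω) = e).card

/-- Local time profile seen from the walker: `ℓ_n(k + 1/2)`. -/
def shiftedProfile {Ω : Type*} (X : ℕ → Ω → ℤ) (n : ℕ) (k : ℤ) (ω : Ω) : ℕ :=
  locTime X n (X n ω + k) ω

/-- `F(y) = e^y / (e^y + e^{-y})`. -/
def walkF (y : ℝ) : ℝ := Real.exp y / (Real.exp y + Real.exp (-y))

/-- The σ-algebra generated by `X_0, …, X_n`. -/
def walkFiltration {Ω : Type*} (X : ℕ → Ω → ℤ) (n : ℕ) : MeasurableSpace Ω :=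
  ⨆ m ∈ Finset.range (n + 1), MeasurableSpace.comap (X m) inferInstance

/-- The drift `Δ^#(ℓ_n) = 2 ℓ_n(-3/2) - ℓ_n(-1/2) - ℓ_n(1/2)`. -/
def Δsharp {Ω : Type*} (X : ℕ → Ω → ℤ) (n : ℕ) (ω : Ω) : ℝ :=
  2 * (shiftedProfile X n (-2) ω : ℝ) - shiftedProfile X n (-1) ω - shiftedProfile X n 0 ω

/-- The integer-valued drift `-Δ^#(ℓ_n)`. -/
def drift {Ω : Type*} (X : ℕ → Ω → ℤ) (n : ℕ) (ω : Ω) : ℤ :=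
  locTime X n (X n ω - 1) ω + locTime X n (X n ω) ω - 2 * locTime X n (X n ω - 2) ω

lemma neg_Δsharp_eq_drift {Ω : Type*} (X : ℕ → Ω → ℤ) (n : ℕ) (ω : Ω) :
    -(Δsharp X n ω) = (drift X n ω : ℝ) := by
  have h2 : X n ω + -2 = X n ω - 2 := by ring
  have h1 : X n ω + -1 = X n ω - 1 := by ring
  simp only [Δsharp, drift, shiftedProfile, add_zero, h1, h2]
  push_cast
  ring

section Deterministic

variable {Ω : Type*} {X : ℕ → Ω → ℤ} {ω : Ω}

lemma locTime_succ (n : ℕ) (e : ℤ) :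
    locTime X (n + 1) e ω
      = locTime X n e ω + if min (X n ω) (X (n + 1) ω) = e then 1 else 0 := by
  unfold locTime
  rw [Finset.range_add_one, Finset.filter_insert]
  split_ifs
  · rw [Finset.card_insert_of_notMem (by simp)]
  · simp

lemma locTime_mono (e : ℤ) : Monotone fun n => locTime X n e ω :=
  monotone_nat_of_le_succ fun n => by rw [locTime_succ]; omega

lemma locTime_le (n : ℕ) (e : ℤ) : locTime X n e ω ≤ n :=
  (Finset.card_filter_le _ _).trans (Finset.card_range n).le

/-- The step at time `n` goes in the direction of the drift as soon as the latter is at least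
`w` in absolute value. -/
structure TameStep (X : ℕ → Ω → ℤ) (ω : Ω) (w : ℕ) (n : ℕ) : Prop where
  step : |X (n + 1) ω - X n ω| = 1
  right : (w : ℤ) ≤ drift X n ω → X (n + 1) ω = X n ω + 1
  left : drift X n ω ≤ -(w : ℤ) → X (n + 1) ω = X n ω - 1

/-- At time `n` the rightmost edge of the walk is `{p, p + 1}` (or `{p - 1, p}`, the walk being
about to discover `{p, p + 1}`), the walk stays next to it, and the local times of the edges
further left double from one edge to the next, up to an error of order `w`. -/
structure Frontier (X : ℕ → Ω → ℤ) (ω : Ω) (w : ℕ) (n : ℕ) (p : ℤ) : Prop where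
  two_le : 2 ≤ p
  pos : X n ω = p - 1 ∨ X n ω = p ∨ X n ω = p + 1
  above : ∀ e, p < e → locTime X n e ω = 0
  le_locTime : p ≤ locTime X n (p - 2) ω
  settled_ge : 2 * locTime X n (p - 3) ω ≤ locTime X n (p - 2) ω + w + 1
  settled_le : 3 ≤ p → locTime X n (p - 2) ω ≤ 2 * locTime X n (p - 3) ω + w + 1
  ge : 2 * locTime X n (p - 2) ω ≤ locTime X n (p - 1) ω + w
  le : locTime X n (p - 1) ω ≤ 2 * locTime X n (p - 2) ω + w + 1
  le_of_pos : X n ω = p - 1 → locTime X n (p - 1) ω ≤ 2 * locTime X n (p - 2) ω + w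
  front_le : locTime X n p ω ≤ 2 * locTime X n (p - 1) ω + w + 1
  front_le_of_pos : X n ω ≠ p + 1 → locTime X n p ω ≤ 2 * locTime X n (p - 1) ω + w
  time_le : n ≤ 3 * locTime X n (p - 2) ω + locTime X n (p - 1) ω + locTime X n p ω

lemma Frontier.mono {w w' n : ℕ} {p : ℤ} (h : Frontier X ω w n p) (hw : w ≤ w') :
    Frontier X ω w' n p where
  two_le := h.two_le
  pos := h.pos
  above := h.above
  le_locTime := h.le_locTime
  settled_ge := h.settled_ge.trans (by omega)
  settled_le hp := (h.settled_le hp).trans (by omega)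
  ge := h.ge.trans (by omega)
  le := h.le.trans (by omega)
  le_of_pos hp := (h.le_of_pos hp).trans (by omega)
  front_le := h.front_le.trans (by omega)
  front_le_of_pos hp := (h.front_le_of_pos hp).trans (by omega)
  time_le := h.time_le

lemma Frontier.time_le_settled {w n : ℕ} {p : ℤ} (h : Frontier X ω w n p) :
    n ≤ 9 * locTime X n (p - 2) ω + 4 * w + 4 := by
  have := h.time_le
  have := h.front_le
  have := h.le
  omega

lemma Frontier.succ {w n : ℕ} {p : ℤ} (h : Frontier X ω w n p) (hw1 : 1 ≤ w)
    (hw : 100 * w ≤ n) (ht : TameStep X ω w n) :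
    (∀ e ≤ p - 2, locTime X (n + 1) e ω = locTime X n e ω) ∧
      (Frontier X ω w (n + 1) p ∨ Frontier X ω w (n + 1) (p + 1)) := by
  have htime := h.time_le_settled
  obtain ⟨h1, h2, h3, h4, h5, h6, h7, h8, h9, h10, h11, h12⟩ := h
  have hX : X (n + 1) ω = X n ω + 1 ∨ X (n + 1) ω = X n ω - 1 := by
    rcases (abs_eq zero_le_one).1 ht.step with h | h <;> omega
  have hr := ht.right
  have hl := ht.left
  unfold drift at hr hl
  have above1 := h3 (p + 1) (by omega)
  rcases h2 with hx | hx | hx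
  · have hX' : X (n + 1) ω = p := by
      rw [hx, show p - 1 - 1 = p - 2 by ring, show p - 1 - 2 = p - 3 by ring] at hr
      have := hr (by omega)
      omega
    have hmin : min (X n ω) (X (n + 1) ω) = p - 1 := by omega
    have hL : ∀ e, locTime X (n + 1) e ω = locTime X n e ω + if p - 1 = e then 1 else 0 :=
      fun e => by rw [locTime_succ, hmin]
    refine ⟨fun e he => by rw [hL]; simp; omega, Or.inl ?_⟩
    have a1 := hL (p - 3)
    have a2 := hL (p - 2)
    have a3 := hL (p - 1)
    have a4 := hL p
    rw [if_neg (by omega)] at a1 a2 a4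
    rw [if_pos rfl] at a3
    have a5 : ∀ e, p < e → locTime X (n + 1) e ω = 0 := fun e he => by
      rw [hL, h3 e he, if_neg (by omega)]
    constructor <;> omega
  · rcases hX with hX | hX
    · have hmin : min (X n ω) (X (n + 1) ω) = p := by omega
      have hL : ∀ e, locTime X (n + 1) e ω = locTime X n e ω + if p = e then 1 else 0 :=
        fun e => by rw [locTime_succ, hmin]
      refine ⟨fun e he => by rw [hL]; simp; omega, Or.inl ?_⟩
      have a1 := hL (p - 3)
      have a2 := hL (p - 2)
      have a3 := hL (p - 1)
      have a4 := hL p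
      rw [if_neg (by omega)] at a1 a2 a3
      rw [if_pos rfl] at a4
      have a5 : ∀ e, p < e → locTime X (n + 1) e ω = 0 := fun e he => by
        rw [hL, h3 e he, if_neg (by omega)]
      constructor <;> omega
    · have hmin : min (X n ω) (X (n + 1) ω) = p - 1 := by omega
      have hL : ∀ e, locTime X (n + 1) e ω = locTime X n e ω + if p - 1 = e then 1 else 0 :=
        fun e => by rw [locTime_succ, hmin]
      refine ⟨fun e he => by rw [hL]; simp; omega, Or.inl ?_⟩
      have a1 := hL (p - 3)
      have a2 := hL (p - 2)
      have a3 := hL (p - 1)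
      have a4 := hL p
      rw [if_neg (by omega)] at a1 a2 a4
      rw [if_pos rfl] at a3
      have a5 : ∀ e, p < e → locTime X (n + 1) e ω = 0 := fun e he => by
        rw [hL, h3 e he, if_neg (by omega)]
      rw [hx] at hr
      constructor <;> omega
  · rw [hx, show p + 1 - 1 = p by ring, show p + 1 - 2 = p - 1 by ring] at hr hl
    rcases hX with hX | hX
    · have hmin : min (X n ω) (X (n + 1) ω) = p + 1 := by omega
      have hL : ∀ e, locTime X (n + 1) e ω = locTime X n e ω + if p + 1 = e then 1 else 0 :=
        fun e => by rw [locTime_succ, hmin]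
      refine ⟨fun e he => by rw [hL]; simp; omega, Or.inr ?_⟩
      have a1 := hL (p - 2)
      have a2 := hL (p - 1)
      have a3 := hL p
      have a4 := hL (p + 1)
      rw [if_neg (by omega)] at a1 a2 a3
      rw [if_pos rfl] at a4
      have a5 : ∀ e, p + 1 < e → locTime X (n + 1) e ω = 0 := fun e he => by
        rw [hL, h3 e (by omega), if_neg (by omega)]
      have e1 : p + 1 - 3 = p - 2 := by ring
      have e2 : p + 1 - 2 = p - 1 := by ring
      have e3 : p + 1 - 1 = p := by ring
      constructor <;> (try simp only [e1, e2, e3]) <;> omega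
    · have hmin : min (X n ω) (X (n + 1) ω) = p := by omega
      have hL : ∀ e, locTime X (n + 1) e ω = locTime X n e ω + if p = e then 1 else 0 :=
        fun e => by rw [locTime_succ, hmin]
      refine ⟨fun e he => by rw [hL]; simp; omega, Or.inl ?_⟩
      have a1 := hL (p - 3)
      have a2 := hL (p - 2)
      have a3 := hL (p - 1)
      have a4 := hL p
      rw [if_neg (by omega)] at a1 a2 a3
      rw [if_pos rfl] at a4
      have a5 : ∀ e, p < e → locTime X (n + 1) e ω = 0 := fun e he => by
        rw [hL, h3 e he, if_neg (by omega)]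
      constructor <;> omega

variable {w : ℕ → ℕ} {N : ℕ}

lemma Frontier.persist (hmono : Monotone w) (hw1 : ∀ n ≥ N, 1 ≤ w n)
    (hw : ∀ n ≥ N, 100 * w n ≤ n) (ht : ∀ n ≥ N, TameStep X ω (w n) n)
    {n : ℕ} {p : ℤ} (hn : N ≤ n) (h : Frontier X ω (w n) n p) {k : ℕ} (hk : n ≤ k) :
    (∀ e ≤ p - 2, locTime X k e ω = locTime X n e ω) ∧ ∃ q ≥ p, Frontier X ω (w k) k q := by
  induction k, hk using Nat.le_induction with
  | base => exact ⟨fun _ _ => rfl, p, le_rfl, h⟩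
  | succ k hk ih =>
    obtain ⟨hL, q, hq, hF⟩ := ih
    obtain ⟨h1, h2⟩ := hF.succ (hw1 k (by omega)) (hw k (by omega)) (ht k (by omega))
    refine ⟨fun e he => (h1 e (by omega)).trans (hL e he), ?_⟩
    have hwk := hmono (Nat.le_succ k)
    rcases h2 with h2 | h2
    · exact ⟨q, hq, h2.mono hwk⟩
    · exact ⟨q + 1, by omega, h2.mono hwk⟩

lemma Frontier.exists_next (hmono : Monotone w) (hw1 : ∀ n ≥ N, 1 ≤ w n)
    (hw : ∀ n ≥ N, 100 * w n ≤ n) (ht : ∀ n ≥ N, TameStep X ω (w n) n)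
    {n : ℕ} {p : ℤ} (hn : N ≤ n) (h : Frontier X ω (w n) n p) :
    ∃ k ≥ n, Frontier X ω (w k) k (p + 1) := by
  by_contra! hcon
  have hstay : ∀ k ≥ n, Frontier X ω (w k) k p := by
    intro k hk
    induction k, hk using Nat.le_induction with
    | base => exact h
    | succ k hk ih =>
      have hwk := hmono (Nat.le_succ k)
      rcases (ih.succ (hw1 k (by omega)) (hw k (by omega)) (ht k (by omega))).2 with h2 | h2
      · exact h2.mono hwk
      · exact absurd (h2.mono hwk) (hcon (k + 1) (by omega))
  set k := n + 10 * locTime X n (p - 2) ω + 10 with hk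
  have h1 := (hstay k (by omega)).time_le_settled
  have h2 := (h.persist hmono hw1 hw ht hn (show n ≤ k by omega)).1 (p - 2) le_rfl
  have h3 := hw k (by omega)
  omega

lemma Frontier.exists_frontier (hmono : Monotone w) (hw1 : ∀ n ≥ N, 1 ≤ w n)
    (hw : ∀ n ≥ N, 100 * w n ≤ n) (ht : ∀ n ≥ N, TameStep X ω (w n) n)
    (h : Frontier X ω (w N) N 2) (y : ℕ) :
    ∃ n ≥ N, Frontier X ω (w n) n (y + 2) := by
  induction y with
  | zero => exact ⟨N, le_rfl, by simpa using h⟩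
  | succ y ih =>
    obtain ⟨n, hn, hF⟩ := ih
    obtain ⟨k, hk, hF'⟩ := hF.exists_next hmono hw1 hw ht hn
    exact ⟨k, by omega, by convert hF' using 1; push_cast; ring⟩

/-- The local times of the edges eventually freeze, and their final values double from one edge
to the next, up to an error of order `w`. -/
lemma Frontier.exists_final (hmono : Monotone w) (hw1 : ∀ n ≥ N, 1 ≤ w n)
    (hw : ∀ n ≥ N, 100 * w n ≤ n) (ht : ∀ n ≥ N, TameStep X ω (w n) n)
    (h : Frontier X ω (w N) N 2) :
    (∀ e : ℤ, ∃ K : ℕ, ∀ n, locTime X n e ω ≤ K) ∧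
      ∃ L : ℕ → ℕ, (∀ y : ℕ, (⨆ n, (locTime X n (y : ℤ) ω : ℝ)) = L y) ∧
        ∀ y, 0 < L y ∧ ∃ n ≥ y, n ≤ 40 * L y ∧
          2 * L y ≤ L (y + 1) + w n + 1 ∧ L (y + 1) ≤ 2 * L y + w n + 1 := by
  have hfr := h.exists_frontier hmono hw1 hw ht
  choose τ hτ hF using hfr
  have hper (y : ℕ) (k : ℕ) (hk : τ y ≤ k) := ((hF y).persist hmono hw1 hw ht (hτ y) hk).1
  have hbd (y : ℕ) (e : ℤ) (he : e ≤ y) (n : ℕ) : locTime X n e ω ≤ locTime X (τ y) e ω := by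
    rcases le_total n (τ y) with hn | hn
    · exact locTime_mono e hn
    · exact (hper y n hn e (by omega)).le
  refine ⟨fun e => ⟨_, hbd e.toNat e e.self_le_toNat⟩, fun y => locTime X (τ y) y ω, ?_, ?_⟩
  · intro y
    refine le_antisymm (ciSup_le fun n => Nat.cast_le.2 (hbd y y le_rfl n)) ?_
    refine le_ciSup (f := fun n => (locTime X n (y : ℤ) ω : ℝ)) ?_ (τ y)
    exact ⟨locTime X (τ y) y ω, by rintro _ ⟨n, rfl⟩; exact Nat.cast_le.2 (hbd y y le_rfl n)⟩
  · intro y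
    have hy := hF (y + 1)
    have e2 : ((y + 1 : ℕ) : ℤ) + 2 - 2 = (y + 1 : ℕ) := by ring
    have e3 : ((y + 1 : ℕ) : ℤ) + 2 - 3 = (y : ℤ) := by push_cast; ring
    have heq : locTime X (τ y) y ω = locTime X (τ (y + 1)) y ω := by
      refine le_antisymm ?_ (hbd y y le_rfl _)
      exact hbd (y + 1) y (by omega) _
    have h1 := hy.time_le_settled
    have h2 := hy.settled_ge
    have h3 := hy.settled_le (by omega)
    have h4 := hy.le_locTime
    have h5 := locTime_le (X := X) (ω := ω) (τ (y + 1)) ((y + 1 : ℕ) : ℤ)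
    have h6 := hw (τ (y + 1)) (hτ _)
    have h7 := hw1 (τ (y + 1)) (hτ _)
    rw [e2, e3] at *
    beta_reduce
    rw [heq]
    exact ⟨by omega, τ (y + 1), by omega, by omega, h2, h3⟩

end Deterministic

lemma tendsto_log_div_of_doubling {L w : ℕ → ℕ}
    (hw : Tendsto (fun n => (w n : ℝ) / n) atTop (nhds 0))
    (hL : ∀ y, 0 < L y ∧ ∃ n ≥ y, n ≤ 40 * L y ∧
      2 * L y ≤ L (y + 1) + w n + 1 ∧ L (y + 1) ≤ 2 * L y + w n + 1) :
    Tendsto (fun y : ℕ => Real.log (L y) / ((y : ℝ) * Real.log 2)) atTop (nhds 1) := by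
  choose hpos n hny hn h1 h2 using hL
  have hntop : Tendsto n atTop atTop := tendsto_atTop_mono hny tendsto_id
  have herr : Tendsto (fun y => 40 * (((w (n y) : ℝ) / n y) + 1 / n y)) atTop (nhds 0) := by
    have := ((hw.comp hntop).add (tendsto_one_div_atTop_nhds_zero_nat.comp hntop)).const_mul 40
    simpa using this
  have hratio : Tendsto (fun y => (L (y + 1) : ℝ) / L y) atTop (nhds 2) := by
    rw [tendsto_iff_norm_sub_tendsto_zero]
    refine squeeze_zero' (Eventually.of_forall fun _ => norm_nonneg _) ?_ herr
    filter_upwards [eventually_ge_atTop 1] with y hy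
    have hLy : (0 : ℝ) < L y := by exact_mod_cast hpos y
    have hny' : (0 : ℝ) < n y := by exact_mod_cast lt_of_lt_of_le hy (hny y)
    have hn' : (n y : ℝ) ≤ 40 * L y := by exact_mod_cast hn y
    have h1' : (2 : ℝ) * L y ≤ L (y + 1) + w (n y) + 1 := by exact_mod_cast h1 y
    have h2' : (L (y + 1) : ℝ) ≤ 2 * L y + w (n y) + 1 := by exact_mod_cast h2 y
    have habs : |(L (y + 1) : ℝ) - 2 * L y| ≤ w (n y) + 1 :=
      abs_le.2 ⟨by linarith, by linarith⟩
    rw [Real.norm_eq_abs, show (L (y + 1) : ℝ) / L y - 2 = (L (y + 1) - 2 * L y) / L y by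
      field_simp, abs_div, abs_of_pos hLy, ← add_div, ← mul_div_assoc,
      div_le_div_iff₀ hLy hny']
    calc |(L (y + 1) : ℝ) - 2 * L y| * n y ≤ (w (n y) + 1) * (40 * L y) := by gcongr
      _ = _ := by ring
  have hlog : Tendsto (fun y => Real.log (L (y + 1)) - Real.log (L y)) atTop
      (nhds (Real.log 2)) := by
    refine (hratio.log two_ne_zero).congr fun y => ?_
    exact Real.log_div (by exact_mod_cast (hpos _).ne') (by exact_mod_cast (hpos _).ne')
  have hces := hlog.cesaro
  simp only [Finset.sum_range_sub fun y => Real.log (L y)] at hces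
  have h0 : Tendsto (fun y : ℕ => (y : ℝ)⁻¹ * Real.log (L 0)) atTop (nhds 0) := by
    simpa using (tendsto_inv_atTop_nhds_zero_nat (𝕜 := ℝ)).mul_const (Real.log (L 0))
  have hl2 : Real.log 2 ≠ 0 := (Real.log_pos one_lt_two).ne'
  have := (hces.add h0).div_const (Real.log 2)
  rw [add_zero, div_self hl2] at this
  refine this.congr fun y => ?_
  rw [← mul_add, sub_add_cancel, ← div_eq_inv_mul, div_div]

section StartPath

/-- A path which crosses the edge `{0, 1}` exactly `2 * m + 1` times, and then crosses the edge
`{1, 2}` forever. -/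
def startPath (m n : ℕ) : ℤ := if n ≤ 2 * m + 1 then n % 2 else 1 + (n + 1) % 2

lemma startPath_zero (m : ℕ) : startPath m 0 = 0 := by simp [startPath]

lemma startPath_step (m n : ℕ) :
    startPath m (n + 1) = startPath m n + 1 ∨ startPath m (n + 1) = startPath m n - 1 := by
  unfold startPath
  split_ifs <;> omega

variable {Ω : Type*} {X : ℕ → Ω → ℤ} {ω : Ω}

lemma locTime_startPath {m N : ℕ} (h : ∀ k ≤ N, X k ω = startPath m k) {n : ℕ} (hn : n ≤ N)
    (e : ℤ) :
    locTime X n e ω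
      = if e = 0 then min n (2 * m + 1) else if e = 1 then n - (2 * m + 1) else 0 := by
  induction n with
  | zero => simp [locTime]
  | succ n ih =>
    have hmin : min (X n ω) (X (n + 1) ω) = if n < 2 * m + 1 then 0 else 1 := by
      rw [h n (by omega), h (n + 1) hn]
      unfold startPath
      split_ifs <;> omega
    rw [locTime_succ, ih (by omega), hmin]
    split_ifs <;> omega

lemma frontier_startPath {m w : ℕ} (hm : 1 ≤ m)
    (h : ∀ k ≤ 6 * m + 4, X k ω = startPath m k) : Frontier X ω w (6 * m + 4) 2 := by
  have hL := locTime_startPath h le_rfl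
  have hx : X (6 * m + 4) ω = 2 := by
    rw [h _ le_rfl]
    unfold startPath
    split_ifs <;> omega
  have habove : ∀ e, 2 < e → locTime X (6 * m + 4) e ω = 0 := fun e he => by
    rw [hL, if_neg (by omega), if_neg (by omega)]
  constructor <;> first | exact habove | (norm_num [hL, hx] <;> omega)

end StartPath

lemma walkF_pos (y : ℝ) : 0 < walkF y := by unfold walkF; positivity

lemma walkF_add_walkF_neg (y : ℝ) : walkF y + walkF (-y) = 1 := by
  unfold walkF
  rw [neg_neg, add_comm (Real.exp (-y)), ← add_div]
  exact div_self (by positivity)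

lemma walkF_lt_one (y : ℝ) : walkF y < 1 := by
  linarith [walkF_add_walkF_neg y, walkF_pos (-y)]

lemma walkF_le_exp (y : ℝ) : walkF y ≤ Real.exp (2 * y) := by
  unfold walkF
  rw [div_le_iff₀ (by positivity), mul_add, ← Real.exp_add, ← Real.exp_add]
  have : 2 * y + -y = y := by ring
  rw [this]
  linarith [Real.exp_pos (2 * y + y)]

section Probability

variable {Ω : Type*} {X : ℕ → Ω → ℤ}

lemma measurable_walkFiltration {m n : ℕ} (h : m ≤ n) : Measurable[walkFiltration X n] (X m) :=
  Measurable.of_comap_le <|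
    le_iSup₂_of_le (f := fun m (_ : m ∈ Finset.range (n + 1)) =>
      MeasurableSpace.comap (X m) inferInstance) m (Finset.mem_range.2 (by omega)) le_rfl

lemma walkFiltration_mono : Monotone (walkFiltration X) := fun _ _ h =>
  biSup_mono fun _ hm => Finset.range_mono (Nat.succ_le_succ h) hm

lemma measurable_locTime_walkFiltration (n : ℕ) (k : ℤ) :
    Measurable[walkFiltration X n] fun ω => locTime X n (X n ω + k) ω := by
  simp only [locTime, Finset.card_filter]
  refine Finset.measurable_fun_sum _ fun m hm => ?_
  have hm := Finset.mem_range.1 hm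
  refine Measurable.ite ?_ measurable_const measurable_const
  exact measurableSet_eq_fun
    ((measurable_walkFiltration hm.le).min (measurable_walkFiltration hm))
    ((measurable_walkFiltration le_rfl).add_const k)

lemma measurable_drift_walkFiltration (n : ℕ) :
    Measurable[walkFiltration X n] (drift X n) := by
  have h (k : ℤ) : Measurable[walkFiltration X n] fun ω => (locTime X n (X n ω + k) ω : ℤ) :=
    measurable_from_top.comp (measurable_locTime_walkFiltration n k)
  have := ((h (-1)).add (h 0)).sub ((h (-2)).const_mul 2)
  convert this using 1
  ext ω
  simp [drift, ← sub_eq_add_neg]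

lemma measurableSet_path (f : ℕ → ℤ) (n : ℕ) :
    MeasurableSet[walkFiltration X n] {ω | ∀ k ≤ n, X k ω = f k} := by
  simp only [Set.ofPred_forall]
  exact MeasurableSet.iInter fun k => MeasurableSet.iInter fun hk =>
    measurable_walkFiltration hk (measurableSet_singleton (f k))

variable [MeasurableSpace Ω] {μ : Measure Ω} [IsProbabilityMeasure μ]

lemma walkFiltration_le (hmeas : ∀ n, Measurable (X n)) (n : ℕ) :
    walkFiltration X n ≤ ‹MeasurableSpace Ω› :=
  iSup₂_le fun m _ => (hmeas m).comap_le

lemma measurable_walkF : Measurable walkF := by unfold walkF; fun_prop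

lemma integrable_walkF {ν : Measure Ω} [IsFiniteMeasure ν] {D : Ω → ℝ} (hD : Measurable D) :
    Integrable (fun ω => walkF (D ω)) ν := by
  refine Integrable.of_bound (measurable_walkF.comp hD).aestronglyMeasurable 1 ?_
  refine Eventually.of_forall fun ω => ?_
  rw [Real.norm_eq_abs, abs_of_pos (walkF_pos _)]
  exact (walkF_lt_one _).le

/-- The law of the step at time `n`, on an event which is known at time `n`. -/
lemma measureReal_step (hmeas : ∀ n, Measurable (X n))
    (hstep : ∀ n, ∀ᵐ ω ∂μ, |X (n + 1) ω - X n ω| = 1)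
    (hdrive : ∀ n,
      μ[(fun ω => if X (n + 1) ω = X n ω + 1 then (1 : ℝ) else 0) | walkFiltration X n]
        =ᵐ[μ] fun ω => walkF (-(Δsharp X n ω)))
    {n : ℕ} {T : Set Ω} (hT : MeasurableSet[walkFiltration X n] T) {s : ℤ}
    (hs : s = 1 ∨ s = -1) :
    μ.real (T ∩ {ω | X (n + 1) ω = X n ω + s}) = ∫ ω in T, walkF (s * drift X n ω) ∂μ := by
  have hm := walkFiltration_le hmeas n
  have hTm : MeasurableSet T := hm _ hT
  have hU (s : ℤ) : MeasurableSet {ω | X (n + 1) ω = X n ω + s} :=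
    measurableSet_eq_fun (hmeas _) ((hmeas n).add_const s)
  have hD : Measurable fun ω => (drift X n ω : ℝ) :=
    measurable_from_top.comp ((measurable_drift_walkFiltration n).mono hm le_rfl)
  have hup : μ.real (T ∩ {ω | X (n + 1) ω = X n ω + 1}) = ∫ ω in T, walkF (drift X n ω) ∂μ := by
    have hind : (fun ω => if X (n + 1) ω = X n ω + 1 then (1 : ℝ) else 0)
        = {ω | X (n + 1) ω = X n ω + 1}.indicator 1 := by
      ext ω; simp [Set.indicator_apply]
    have hint : Integrable (fun ω => if X (n + 1) ω = X n ω + 1 then (1 : ℝ) else 0) μ := by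
      rw [hind]
      exact (integrable_const (1 : ℝ)).indicator (hU 1)
    have h1 := setIntegral_condExp hm hint hT
    rw [setIntegral_congr_ae hTm ((hdrive n).mono fun ω h _ => h)] at h1
    simp only [neg_Δsharp_eq_drift] at h1
    rw [h1, hind, integral_indicator_one (hU 1), measureReal_restrict_apply (hU 1),
      Set.inter_comm]
  rcases hs with rfl | rfl
  · simpa using hup
  · have hsum : μ.real (T ∩ {ω | X (n + 1) ω = X n ω + 1})
        + μ.real (T ∩ {ω | X (n + 1) ω = X n ω + -1}) = μ.real T := by
      rw [← measureReal_inter_add_sdiff (s := T) (hU 1)]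
      congr 1
      refine measureReal_congr ?_
      filter_upwards [hstep n] with ω hω
      refine propext (and_congr_right fun _ => ?_)
      change X (n + 1) ω = X n ω + -1 ↔ ¬ X (n + 1) ω = X n ω + 1
      rcases (abs_eq zero_le_one).1 hω with h | h <;> omega
    have hint : ∫ ω in T, walkF (drift X n ω) ∂μ + ∫ ω in T, walkF (-drift X n ω) ∂μ
        = μ.real T := by
      rw [← integral_add (integrable_walkF hD)
        (integrable_walkF (D := fun ω => -(drift X n ω : ℝ)) hD.neg)]
      simp [walkF_add_walkF_neg]
    simp only [Int.cast_neg, Int.cast_one, neg_one_mul]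
    linarith

/-- Every finite nearest-neighbour path started at `0` has positive probability. -/
lemma measureReal_path_pos (hmeas : ∀ n, Measurable (X n)) (hX0 : ∀ᵐ ω ∂μ, X 0 ω = 0)
    (hstep : ∀ n, ∀ᵐ ω ∂μ, |X (n + 1) ω - X n ω| = 1)
    (hdrive : ∀ n,
      μ[(fun ω => if X (n + 1) ω = X n ω + 1 then (1 : ℝ) else 0) | walkFiltration X n]
        =ᵐ[μ] fun ω => walkF (-(Δsharp X n ω)))
    {f : ℕ → ℤ} (hf0 : f 0 = 0) (hf : ∀ n, f (n + 1) = f n + 1 ∨ f (n + 1) = f n - 1) (n : ℕ) :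
    0 < μ.real {ω | ∀ k ≤ n, X k ω = f k} := by
  induction n with
  | zero =>
    have : μ.real {ω | ∀ k ≤ 0, X k ω = f k} = 1 := by
      rw [← probReal_univ (μ := μ)]
      refine measureReal_congr (eventuallyEq_univ.2 ?_)
      filter_upwards [hX0] with ω hω
      simpa [hf0] using hω
    rw [this]
    exact one_pos
  | succ n ih =>
    obtain ⟨s, hs, hfs⟩ : ∃ s : ℤ, (s = 1 ∨ s = -1) ∧ f (n + 1) = f n + s := by
      rcases hf n with h | h
      · exact ⟨1, Or.inl rfl, h⟩
      · exact ⟨-1, Or.inr rfl, by omega⟩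
    have heq : {ω | ∀ k ≤ n + 1, X k ω = f k}
        = {ω | ∀ k ≤ n, X k ω = f k} ∩ {ω | X (n + 1) ω = X n ω + s} := by
      ext ω
      simp only [Set.mem_ofPred_eq, Set.mem_inter_iff, Nat.le_succ_iff, or_imp, forall_and,
        forall_eq]
      refine and_congr_right fun h => ?_
      rw [h n le_rfl, ← hfs]
    have hD : Measurable fun ω => (s : ℝ) * drift X n ω :=
      (measurable_from_top.comp ((measurable_drift_walkFiltration n).mono
        (walkFiltration_le hmeas n) le_rfl)).const_mul _
    rw [heq, measureReal_step hmeas hstep hdrive (measurableSet_path f n) hs,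
      integral_pos_iff_support_of_nonneg (fun ω => (walkF_pos _).le)
        (integrable_walkF hD).integrableOn]
    have : (Function.support fun ω => walkF (s * drift X n ω)) = Set.univ :=
      Set.eq_univ_of_forall fun ω => (walkF_pos _).ne'
    rw [this, Measure.restrict_apply_univ]
    exact (ENNReal.toReal_pos_iff.1 ih).1

/-- It is unlikely that the walk makes a step against a strong drift. -/
lemma measureReal_step_against_drift (hmeas : ∀ n, Measurable (X n))
    (hstep : ∀ n, ∀ᵐ ω ∂μ, |X (n + 1) ω - X n ω| = 1)
    (hdrive : ∀ n,
      μ[(fun ω => if X (n + 1) ω = X n ω + 1 then (1 : ℝ) else 0) | walkFiltration X n]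
        =ᵐ[μ] fun ω => walkF (-(Δsharp X n ω)))
    {n : ℕ} {T : Set Ω} (hT : MeasurableSet[walkFiltration X n] T) {s : ℤ}
    (hs : s = 1 ∨ s = -1) (w : ℕ) :
    μ.real (T ∩ {ω | s * drift X n ω ≤ -w} ∩ {ω | X (n + 1) ω = X n ω + s})
      ≤ Real.exp (-2 * w) * μ.real T := by
  have hm := walkFiltration_le hmeas n
  have hT' : MeasurableSet[walkFiltration X n] (T ∩ {ω | s * drift X n ω ≤ -w}) :=
    hT.inter (measurableSet_le ((measurable_drift_walkFiltration n).const_mul s)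
      measurable_const)
  have hD : Measurable fun ω => (s : ℝ) * drift X n ω :=
    (measurable_from_top.comp ((measurable_drift_walkFiltration n).mono hm le_rfl)).const_mul _
  rw [measureReal_step hmeas hstep hdrive hT' hs]
  calc ∫ ω in T ∩ {ω | s * drift X n ω ≤ -w}, walkF (s * drift X n ω) ∂μ
      ≤ ∫ _ in T ∩ {ω | s * drift X n ω ≤ -w}, Real.exp (-2 * w) ∂μ := by
        refine setIntegral_mono_on (integrable_walkF hD).integrableOn
          (integrable_const _).integrableOn (hm _ hT') fun ω hω => ?_
        refine (walkF_le_exp _).trans (Real.exp_le_exp.2 ?_)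
        have : (s : ℝ) * drift X n ω ≤ -w := by exact_mod_cast hω.2
        linarith
    _ ≤ Real.exp (-2 * w) * μ.real T := by
        rw [setIntegral_const, smul_eq_mul, mul_comm]
        exact mul_le_mul_of_nonneg_left (measureReal_mono Set.inter_subset_left)
          (Real.exp_pos _).le

/-- If the thresholds `w n` grow fast enough, then, on any event of positive probability which is
known at time `N`, with positive probability all the steps from time `N` on are tame. -/
lemma measure_tame_pos (hmeas : ∀ n, Measurable (X n))
    (hstep : ∀ n, ∀ᵐ ω ∂μ, |X (n + 1) ω - X n ω| = 1)
    (hdrive : ∀ n,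
      μ[(fun ω => if X (n + 1) ω = X n ω + 1 then (1 : ℝ) else 0) | walkFiltration X n]
        =ᵐ[μ] fun ω => walkF (-(Δsharp X n ω)))
    {w : ℕ → ℕ} {N : ℕ} {c : ℝ} (hc : HasSum (fun n => 2 * Real.exp (-2 * w (n + N))) c)
    (hc1 : c < 1) {T : Set Ω} (hT : MeasurableSet[walkFiltration X N] T) (hT0 : 0 < μ.real T) :
    0 < μ (T ∩ {ω | ∀ n ≥ N, TameStep X ω (w n) n}) := by
  let B (s : ℤ) (n : ℕ) : Set Ω :=
    T ∩ {ω | s * drift X n ω ≤ -w n} ∩ {ω | X (n + 1) ω = X n ω + s}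
  have hTn (n : ℕ) : MeasurableSet[walkFiltration X (n + N)] T :=
    walkFiltration_mono (Nat.le_add_left N n) T hT
  have hB (n : ℕ) : μ (B 1 (n + N) ∪ B (-1) (n + N))
      ≤ ENNReal.ofReal (2 * Real.exp (-2 * w (n + N)) * μ.real T) := by
    rw [← ofReal_measureReal]
    refine ENNReal.ofReal_le_ofReal ((measureReal_union_le _ _).trans ?_)
    have h1 := measureReal_step_against_drift hmeas hstep hdrive (hTn n) (Or.inl rfl) (w (n + N))
    have h2 := measureReal_step_against_drift hmeas hstep hdrive (hTn n) (Or.inr rfl) (w (n + N))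
    linarith
  have hsum := hc.mul_right (μ.real T)
  have hU : μ (⋃ n, (B 1 (n + N) ∪ B (-1) (n + N))) < μ T := by
    refine ((measure_iUnion_le _).trans (ENNReal.tsum_le_tsum hB)).trans_lt ?_
    rw [← ENNReal.ofReal_tsum_of_nonneg (fun n => by positivity) hsum.summable, hsum.tsum_eq,
      ← ofReal_measureReal (μ := μ) (s := T), ENNReal.ofReal_lt_ofReal_iff hT0]
    nlinarith
  refine (tsub_pos_of_lt hU).trans_le ((le_measure_sdiff).trans (measure_mono_ae ?_))
  filter_upwards [ae_all_iff.2 hstep] with ω hω hmem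
  obtain ⟨hωT, hωB⟩ := hmem
  refine ⟨hωT, fun n hn => ?_⟩
  obtain ⟨k, rfl⟩ := Nat.exists_eq_add_of_le' hn
  have h1 : ω ∉ B 1 (k + N) := fun h => hωB (Set.mem_iUnion.2 ⟨k, Or.inl h⟩)
  have h2 : ω ∉ B (-1) (k + N) := fun h => hωB (Set.mem_iUnion.2 ⟨k, Or.inr h⟩)
  have hst : X (k + N + 1) ω = X (k + N) ω + 1 ∨ X (k + N + 1) ω = X (k + N) ω + -1 := by
    rcases (abs_eq zero_le_one).1 (hω (k + N)) with h | h <;> omega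
  refine ⟨hω _, fun hd => ?_, fun hd => ?_⟩
  · exact hst.resolve_right fun h => h2 ⟨⟨hωT, by simp only [Set.mem_ofPred_eq]; omega⟩, h⟩
  · exact hst.resolve_left fun h => h1 ⟨⟨hωT, by simp only [Set.mem_ofPred_eq]; omega⟩, h⟩

end Probability

lemma tendsto_ceil_log_div :
    Tendsto (fun n : ℕ => (⌈Real.log n⌉₊ : ℝ) / n) atTop (nhds 0) := by
  have h1 : Tendsto (fun n : ℕ => Real.log n / n) atTop (nhds 0) :=
    (Real.isLittleO_log_id_atTop.tendsto_div_nhds_zero).comp tendsto_natCast_atTop_atTop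
  have h2 := h1.add (tendsto_one_div_atTop_nhds_zero_nat (𝕜 := ℝ))
  rw [add_zero] at h2
  refine squeeze_zero (fun n => by positivity) (fun n => ?_) h2
  rw [← add_div]
  gcongr
  exact (Nat.ceil_lt_add_one (Real.log_natCast_nonneg n)).le

lemma summable_exp_ceil_log :
    Summable fun n : ℕ => 2 * Real.exp (-2 * (⌈Real.log n⌉₊ : ℝ)) := by
  refine Summable.mul_left 2 ?_
  rw [← summable_nat_add_iff 1]
  refine Summable.of_nonneg_of_le (fun n => (Real.exp_pos _).le) (fun n => ?_)
    ((summable_nat_add_iff 1).2 (Real.summable_one_div_nat_pow.2 one_lt_two))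
  have hn : (0 : ℝ) < (n + 1 : ℕ) := by positivity
  calc Real.exp (-2 * (⌈Real.log (n + 1 : ℕ)⌉₊ : ℝ))
      ≤ Real.exp (-(Real.log (n + 1 : ℕ) * 2)) := by
        refine Real.exp_le_exp.2 ?_
        linarith [Nat.le_ceil (Real.log (n + 1 : ℕ))]
    _ = 1 / ((n + 1 : ℕ) : ℝ) ^ 2 := by
        rw [Real.exp_neg, Real.exp_mul, Real.exp_log hn, one_div]
        norm_cast

/-- for the walk driven by `-Δ^#`, with positive probability the total number
`L_∞(e) = lim_n L_n(e) = sup_n L_n(e)` of jumps along each edge is finite, and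
`log L_∞(y + 1/2) / (y log 2) → 1` as `y → +∞`. -/
theorem stmt18 {Ω : Type*} [MeasurableSpace Ω] (μ : Measure Ω) [IsProbabilityMeasure μ]
    (X : ℕ → Ω → ℤ) (hmeas : ∀ n, Measurable (X n))
    (hX0 : ∀ᵐ ω ∂μ, X 0 ω = 0)
    (hstep : ∀ n, ∀ᵐ ω ∂μ, |X (n + 1) ω - X n ω| = 1)
    (hdrive : ∀ n,
      μ[(fun ω => if X (n + 1) ω = X n ω + 1 then (1 : ℝ) else 0) | walkFiltration X n]
        =ᵐ[μ] fun ω => walkF (-(Δsharp X n ω))) :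
    0 < μ {ω | (∀ e : ℤ, ∃ N : ℕ, ∀ n : ℕ, locTime X n e ω ≤ N) ∧
        Tendsto (fun y : ℕ =>
            Real.log (⨆ n : ℕ, (locTime X n (y : ℤ) ω : ℝ)) / ((y : ℝ) * Real.log 2))
          atTop (nhds 1)} := by
  set w : ℕ → ℕ := fun n => ⌈Real.log n⌉₊ with hw
  have hmono : Monotone w := monotone_nat_of_le_succ fun n => by
    rcases n.eq_zero_or_pos with rfl | hn
    · simp [hw]
    · exact Nat.ceil_mono (Real.log_le_log (by exact_mod_cast hn) (by push_cast; linarith))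
  have htail := tendsto_sum_nat_add fun n => 2 * Real.exp (-2 * (w n : ℝ))
  obtain ⟨N₀, hN₀⟩ := eventually_atTop.1 <| (htail.eventually_lt_const one_pos).and <|
    (tendsto_ceil_log_div.eventually_lt_const (show (0 : ℝ) < 1 / 100 by norm_num))
  set m := N₀ + 1 with hm
  set N := 6 * m + 4 with hN
  have hw1 : ∀ n ≥ N, 1 ≤ w n := fun n hn =>
    Nat.one_le_ceil_iff.2 (Real.log_pos (by exact_mod_cast (by omega : 1 < n)))
  have hw100 : ∀ n ≥ N, 100 * w n ≤ n := fun n hn => by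
    have h := (hN₀ n (by omega)).2
    rw [div_lt_div_iff₀ (by exact_mod_cast (by omega : 0 < n)) (by norm_num)] at h
    have : (100 : ℝ) * w n ≤ n := by linarith
    exact_mod_cast this
  have hc : HasSum (fun n => 2 * Real.exp (-2 * (w (n + N) : ℝ))) _ :=
    ((summable_nat_add_iff N).2 summable_exp_ceil_log).hasSum
  refine (measure_tame_pos hmeas hstep hdrive hc (hN₀ N (by omega)).1
    (measurableSet_path (startPath m) N)
    (measureReal_path_pos hmeas hX0 hstep hdrive (startPath_zero m) (startPath_step m) N)).trans_le
    (measure_mono ?_)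
  rintro ω ⟨hstart, htame⟩
  obtain ⟨hfin, L, hL, hLy⟩ :=
    (frontier_startPath (by omega) hstart).exists_final hmono hw1 hw100 htame
  refine ⟨hfin, ?_⟩
  simp only [hL]
  exact tendsto_log_div_of_doubling tendsto_ceil_log_div hLy
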